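/- Let q > 1000 be a prime power, K > q²/2, t ≤ 10, and let C ⊆ F_q^K be the dual code of a [K, K−t, 2δ]_q code. Let β ≥ (40·q^{t+2}·ln q)/K. For a random Max K-CSP(C) instance Φ with m = βn constraints on n variables, with probability 1 − o(1) as n → ∞, every subgraph of G_Φ induced by at most 2m left vertices and at most 2n right vertices contains at most 17·m·K/q edges. -/

import Mathlib

open Classical in
/-- The probability of an event `E` in a finite sample space under the uniform
distribution. -/
noncomputable def prUnif {Ω : Type*} [Fintype Ω] (E : Set Ω) : ℝ :=
  (E.ncard : ℝ) / (Fintype.card Ω : ℝ)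

/-- An exponential Chernoff bound for the number of coordinates
of a uniform function `ι → V` lying in `R`, in counting form. -/
theorem card_many_hits_mul_le {ι V : Type*} [Fintype ι] [DecidableEq ι] [Fintype V] [DecidableEq V]
    (R : Finset V) (s θ : ℝ) (hθ : 0 ≤ θ) :
    ((Finset.univ.filter fun g : ι → V =>
        s < ((Finset.univ.filter fun i => g i ∈ R).card : ℝ)).card : ℝ) * Real.exp (θ * s) ≤
      (Fintype.card V + (Real.exp θ - 1) * R.card) ^ Fintype.card ι := by
  have hsum : ∑ v : V, (if v ∈ R then Real.exp θ else 1)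
      = Fintype.card V + (Real.exp θ - 1) * R.card := by
    have : ∀ v : V, (if v ∈ R then Real.exp θ else 1)
        = 1 + (if v ∈ R then Real.exp θ - 1 else 0) := by
      intro v; split_ifs <;> ring
    simp_rw [this, Finset.sum_add_distrib]
    simp only [Finset.sum_const, Finset.card_univ, Finset.sum_ite_mem, Finset.univ_inter,
      nsmul_eq_mul]
    ring
  have hprod : (∑ v : V, (if v ∈ R then Real.exp θ else 1)) ^ Fintype.card ι
      = ∑ g : ι → V, Real.exp (θ * ((Finset.univ.filter fun i => g i ∈ R).card : ℝ)) := by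
    have h := Fintype.prod_sum (fun (_ : ι) (v : V) => if v ∈ R then Real.exp θ else 1)
    rw [Finset.prod_const, Finset.card_univ] at h
    rw [h]
    refine Finset.sum_congr rfl fun g _ => ?_
    rw [Finset.prod_ite, Finset.prod_const, Finset.prod_const_one, mul_one, ← Real.exp_nat_mul,
      mul_comm]
  rw [← hsum, hprod, ← nsmul_eq_mul, ← Finset.sum_const]
  calc _ ≤ ∑ g ∈ Finset.univ.filter fun g : ι → V =>
          s < ((Finset.univ.filter fun i => g i ∈ R).card : ℝ),
          Real.exp (θ * ((Finset.univ.filter fun i => g i ∈ R).card : ℝ)) := by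
        refine Finset.sum_le_sum fun g hg => ?_
        have := (Finset.mem_filter.1 hg).2
        exact Real.exp_le_exp.2 (mul_le_mul_of_nonneg_left this.le hθ)
    _ ≤ _ := Finset.sum_le_sum_of_subset_of_nonneg (Finset.subset_univ _)
        fun _ _ _ => (Real.exp_pos _).le

/-- The number of subsets of size at most `k`, bounded through the binomial theorem. -/
theorem card_finset_card_le_mul_pow_le (V : Type*) [Fintype V] [DecidableEq V] (k : ℕ)
    (x : ℝ) (hx : 0 ≤ x) (hx1 : x ≤ 1) :
    ((Finset.univ.filter fun R : Finset V => R.card ≤ k).card : ℝ) * x ^ k ≤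
      (1 + x) ^ Fintype.card V := by
  have h := Finset.prod_one_add (f := fun _ : V => x) Finset.univ
  simp only [Finset.prod_const, Finset.card_univ, Finset.powerset_univ] at h
  rw [h, ← nsmul_eq_mul, ← Finset.sum_const]
  calc _ ≤ ∑ R ∈ Finset.univ.filter fun R : Finset V => R.card ≤ k, x ^ R.card :=
        Finset.sum_le_sum fun R hR => pow_le_pow_of_le_one hx hx1 (Finset.mem_filter.1 hR).2
    _ ≤ _ := Finset.sum_le_sum_of_subset_of_nonneg (Finset.subset_univ _)
        fun _ _ _ => pow_nonneg hx _

/-- The dual of a linear code of dimension `k - t` in `F ^ k` has `|F| ^ t` elements. -/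
theorem ncard_dual_code {F : Type*} [Field F] [Fintype F] {ι : Type*} [Fintype ι]
    [DecidableEq ι] (W : Submodule F (ι → F)) {t : ℕ} (ht : t ≤ Fintype.card ι)
    (hW : Module.finrank F W = Fintype.card ι - t) :
    {c : ι → F | ∀ d ∈ W, ∑ j, c j * d j = 0}.ncard = Fintype.card F ^ t := by
  have hB : (Matrix.toBilin' (1 : Matrix ι ι F)).Nondegenerate :=
    LinearMap.BilinForm.nondegenerate_toBilin'_of_det_ne_zero' _ (by simp)
  have h1 := LinearMap.BilinForm.finrank_orthogonal hB W
  rw [hW, Module.finrank_fintype_fun_eq_card, Nat.sub_sub_self ht] at h1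
  have h2 : {c : ι → F | ∀ d ∈ W, ∑ j, c j * d j = 0}
      = (LinearMap.BilinForm.orthogonal (Matrix.toBilin' (1 : Matrix ι ι F)) W : Set _) := by
    ext c
    simp only [Set.mem_ofPred_eq, SetLike.mem_coe, LinearMap.BilinForm.mem_orthogonal_iff,
      Matrix.toBilin'_apply', Matrix.one_mulVec, dotProduct]
    simp only [mul_comm]
  rw [h2, ← Nat.card_coe_set_eq]
  have := Module.natCard_eq_pow_finrank (K := F)
    (V := LinearMap.BilinForm.orthogonal (Matrix.toBilin' (1 : Matrix ι ι F)) W)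
  rw [h1, Nat.card_eq_fintype_card (α := F)] at this
  exact this

theorem pow_le_two_mul_card_injective (K n : ℕ) (hn : 2 * K ^ 2 ≤ n) (hn0 : 0 < n) :
    (n : ℝ) ^ K ≤ 2 * Nat.card {T : Fin K → Fin n // Function.Injective T} := by
  have hcard : Nat.card {T : Fin K → Fin n // Function.Injective T} = n.descFactorial K := by
    rw [Nat.card_congr (Equiv.subtypeInjectiveEquivEmbedding _ _), Nat.card_eq_fintype_card,
      Fintype.card_embedding_eq, Fintype.card_fin, Fintype.card_fin]
  have hKn : K ≤ n := by nlinarith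
  have hn' : (0 : ℝ) < n := by exact_mod_cast hn0
  have h2 : (2 : ℝ) * K ^ 2 ≤ n := by exact_mod_cast hn
  have hK' : (K : ℝ) ≤ n := by exact_mod_cast hKn
  have hbern := one_add_mul_le_pow (a := -((K : ℝ) / n))
    (by have : (K : ℝ) / n ≤ 1 := (div_le_one hn').2 hK'
        linarith) K
  have hq : (K : ℝ) * (K / n) ≤ 1 / 2 := by
    rw [← mul_div_assoc, div_le_iff₀ hn']; nlinarith
  have hhalf : (1 : ℝ) / 2 ≤ (1 + -((K : ℝ) / n)) ^ K := by linarith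
  have hdesc : ((n : ℝ) - K) ^ K ≤ n.descFactorial K := by
    have := Nat.pow_sub_le_descFactorial n K
    calc ((n : ℝ) - K) ^ K ≤ ((n + 1 - K : ℕ) : ℝ) ^ K := by
          apply pow_le_pow_left₀ (by linarith)
          rw [Nat.cast_sub (by omega)]; push_cast; linarith
      _ ≤ _ := by exact_mod_cast this
  have heq : (n : ℝ) - K = n * (1 + -((K : ℝ) / n)) := by field_simp; ring
  rw [heq, mul_pow] at hdesc
  rw [hcard]
  have hpow := pow_pos hn' K
  nlinarith

/-- The number of constraints (scope, shift) having, for some codeword `c ∈ C`, more than `s`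
edges from the vertex of the assignment `c - b` into `R`. -/
theorem card_overloaded_mul_le {F : Type*} [Field F] [Fintype F] [DecidableEq F] {n K : ℕ}
    (C : Finset (Fin K → F)) (R : Finset (Fin n × F)) (s θ : ℝ) (hθ : 0 ≤ θ) :
    ({x : {T : Fin K → Fin n // Function.Injective T} × (Fin K → F) | ∃ c ∈ C,
        s < ((Finset.univ.filter fun j => (x.1.1 j, c j - x.2 j) ∈ R).card : ℝ)}.ncard : ℝ)
      * Real.exp (θ * s) ≤
      C.card * (n * Fintype.card F + (Real.exp θ - 1) * R.card) ^ K := by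
  classical
  set G := Finset.univ.filter fun g : Fin K → Fin n × F =>
        s < ((Finset.univ.filter fun i => g i ∈ R).card : ℝ) with hG
  have hle : {x : {T : Fin K → Fin n // Function.Injective T} × (Fin K → F) | ∃ c ∈ C,
        s < ((Finset.univ.filter fun j => (x.1.1 j, c j - x.2 j) ∈ R).card : ℝ)}.ncard
        ≤ C.card * G.card := by
    have hsub : {x : {T : Fin K → Fin n // Function.Injective T} × (Fin K → F) | ∃ c ∈ C,
        s < ((Finset.univ.filter fun j => (x.1.1 j, c j - x.2 j) ∈ R).card : ℝ)} ⊆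
        ((C.biUnion fun c => Finset.univ.filter fun
          x : {T : Fin K → Fin n // Function.Injective T} × (Fin K → F) =>
          s < ((Finset.univ.filter fun j => (x.1.1 j, c j - x.2 j) ∈ R).card : ℝ) :
          Finset _) : Set _) := by
      intro x hx
      simpa using hx
    refine (Set.ncard_le_ncard hsub (Finset.finite_toSet _)).trans ?_
    rw [Set.ncard_coe_finset]
    refine Finset.card_biUnion_le_card_mul _ _ _ fun c _ => ?_
    refine Finset.card_le_card_of_injOn (fun x j => (x.1.1 j, c j - x.2 j)) ?_ ?_
    · intro x hx
      simpa [hG] using hx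
    · rintro ⟨⟨T, hT⟩, b⟩ - ⟨⟨T', hT'⟩, b'⟩ - h
      have h' := fun j => Prod.ext_iff.1 (congrFun h j)
      have h1 : T = T' := funext fun j => (h' j).1
      have h2 : b = b' := funext fun j => sub_right_injective (h' j).2
      subst h1 h2
      rfl
  have hG' := card_many_hits_mul_le (ι := Fin K) R s θ hθ
  rw [← hG, Fintype.card_prod, Fintype.card_fin, Fintype.card_fin] at hG'
  push_cast at hG'
  calc _ ≤ ((C.card * G.card : ℕ) : ℝ) * Real.exp (θ * s) := by
        gcongr
    _ = C.card * (G.card * Real.exp (θ * s)) := by push_cast; ring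
    _ ≤ _ := by gcongr

open Classical in
/-- If at most `B` constraints are overloaded, few edges join `L` and `R`: the vertices of the
other constraints have at most `s` neighbours in `R` each. -/
theorem sum_edges_le {F : Type*} [Field F] [Fintype F] [DecidableEq F] {n K m : ℕ}
    (C : Finset (Fin K → F))
    (ω : Fin m → ({T : Fin K → Fin n // Function.Injective T} × (Fin K → F)))
    (L : Finset (Fin m × (Fin K → F))) (hL : ∀ p ∈ L, (fun j => p.2 j + (ω p.1).2 j) ∈ C)
    (R : Finset (Fin n × F)) (s : ℝ) (hs : 0 ≤ s) (B : Finset (Fin m))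
    (hB : ∀ i, (∃ c ∈ C, s < ((Finset.univ.filter fun j =>
        ((ω i).1.1 j, c j - (ω i).2 j) ∈ R).card : ℝ)) → i ∈ B) :
    (∑ p ∈ L, ∑ r ∈ R,
        if ∃ j : Fin K, (ω p.1).1.1 j = r.1 ∧ p.2 j = r.2 then (1 : ℝ) else 0) ≤
      L.card * s + B.card * C.card * K := by
  have hdeg : ∀ p ∈ L, (∑ r ∈ R,
        if ∃ j : Fin K, (ω p.1).1.1 j = r.1 ∧ p.2 j = r.2 then (1 : ℝ) else 0) ≤
        s + if p.1 ∈ B then (K : ℝ) else 0 := by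
    intro p hp
    have hle : (R.filter fun r => ∃ j : Fin K, (ω p.1).1.1 j = r.1 ∧ p.2 j = r.2).card ≤
        (Finset.univ.filter fun j => ((ω p.1).1.1 j, p.2 j) ∈ R).card := by
      refine (Finset.card_le_card (t := (Finset.univ.filter fun j =>
        ((ω p.1).1.1 j, p.2 j) ∈ R).image fun j => ((ω p.1).1.1 j, p.2 j)) ?_).trans
        Finset.card_image_le
      rintro ⟨x, a⟩ hr
      obtain ⟨hr, j, rfl, rfl⟩ := Finset.mem_filter.1 hr
      exact Finset.mem_image.2 ⟨j, Finset.mem_filter.2 ⟨Finset.mem_univ _, hr⟩, rfl⟩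
    have hle' : ((R.filter fun r => ∃ j : Fin K, (ω p.1).1.1 j = r.1 ∧ p.2 j = r.2).card : ℝ) ≤
        (Finset.univ.filter fun j => ((ω p.1).1.1 j, p.2 j) ∈ R).card := by exact_mod_cast hle
    rw [Finset.sum_boole]
    refine hle'.trans ?_
    split_ifs with hi
    · have : (Finset.univ.filter fun j => ((ω p.1).1.1 j, p.2 j) ∈ R).card ≤ K :=
        (Finset.card_le_univ _).trans_eq (Fintype.card_fin K)
      have : ((Finset.univ.filter fun j => ((ω p.1).1.1 j, p.2 j) ∈ R).card : ℝ) ≤ K := by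
        exact_mod_cast this
      linarith
    · rw [add_zero]
      by_contra! hlt
      exact hi (hB p.1 ⟨_, hL p hp, by simpa using hlt⟩)
  have hcard : (L.filter fun p => p.1 ∈ B).card ≤ B.card * C.card := by
    rw [← Finset.card_product]
    refine Finset.card_le_card_of_injOn (fun p => (p.1, fun j => p.2 j + (ω p.1).2 j)) ?_ ?_
    · intro p hp
      obtain ⟨hp, hi⟩ := Finset.mem_filter.1 hp
      exact Finset.mem_product.2 ⟨hi, hL p hp⟩
    · rintro ⟨i, α⟩ - ⟨i', α'⟩ - h
      obtain ⟨h1, h2⟩ := Prod.ext_iff.1 h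
      dsimp only at h1 h2
      subst h1
      have : α = α' := funext fun j => add_right_cancel (congrFun h2 j)
      rw [this]
  refine (Finset.sum_le_sum hdeg).trans ?_
  rw [Finset.sum_add_distrib, Finset.sum_const, nsmul_eq_mul, ← Finset.sum_filter,
    Finset.sum_const, nsmul_eq_mul]
  have : ((L.filter fun p => p.1 ∈ B).card : ℝ) ≤ B.card * C.card := by exact_mod_cast hcard
  gcongr

theorem log_le_div_hundred {x : ℝ} (hx : 1000 < x) : Real.log x ≤ x / 100 := by
  have h1 : Real.log x = 10 * Real.log 2 + Real.log (x / 1024) := by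
    rw [Real.log_div (by linarith) (by norm_num), show (1024 : ℝ) = 2 ^ 10 by norm_num,
      Real.log_pow]
    push_cast; ring
  have h2 := Real.log_le_sub_one_of_pos (show 0 < x / 1024 by linarith)
  have h3 := Real.log_two_lt_d9
  linarith

theorem pow_le_exp_div_four {x : ℝ} (hx : 1000 < x) {k : ℕ} (hk : k ≤ 11) :
    x ^ k ≤ Real.exp (x / 4) := by
  calc x ^ k ≤ x ^ 11 := pow_le_pow_right₀ (by linarith) hk
    _ = Real.exp (11 * Real.log x) := by
        rw [mul_comm, Real.exp_mul, Real.exp_log (by linarith)]; norm_cast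
    _ ≤ _ := Real.exp_le_exp.2 (by linarith [log_le_div_hundred hx])

/-- A random constraint is overloaded with probability at most `exp (-3K/q)`. -/
theorem overloaded_le_exp {q : ℝ} (hq : 1000 < q) {K t : ℕ} (hK : q ^ 2 / 2 < K) (ht : t ≤ 10)
    {n r N B : ℝ} (hn : 0 < n) (hr : r ≤ 2 * n) (hr0 : 0 ≤ r) (hN : (n * q) ^ K ≤ 2 * N)
    (hB : B * Real.exp (Real.log 2 * (8 * K / q)) ≤ q ^ t * (n * q + r) ^ K) :
    B ≤ Real.exp (-(3 * (K / q))) * N := by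
  have hq0 : 0 < q := by linarith
  have hKq : q / 2 ≤ K / q := by rw [le_div_iff₀ hq0]; nlinarith
  have h1 : (n * q + r) ^ K ≤ (n * q) ^ K * Real.exp (2 * (K / q)) := by
    calc (n * q + r) ^ K ≤ (n * q * Real.exp (2 / q)) ^ K := by
          gcongr
          have := Real.add_one_le_exp (2 / q)
          calc n * q + r ≤ n * q * (2 / q + 1) := by field_simp; linarith
            _ ≤ _ := by gcongr
      _ = _ := by rw [mul_pow, ← Real.exp_nat_mul]; congr 2; ring
  have h2 : 2 * q ^ t ≤ Real.exp (K / q / 2) := by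
    calc 2 * q ^ t ≤ q ^ (t + 1) := by
          rw [pow_succ']; gcongr; linarith
      _ ≤ Real.exp (q / 4) := pow_le_exp_div_four hq (by omega)
      _ ≤ _ := Real.exp_le_exp.2 (by linarith)
  have hN0 : 0 ≤ N := by
    have : 0 ≤ (n * q) ^ K := by positivity
    linarith
  have hlog := Real.log_two_gt_d9
  have hpos := Real.exp_pos (Real.log 2 * (8 * K / q))
  refine le_of_mul_le_mul_right (hB.trans ?_) hpos
  calc q ^ t * (n * q + r) ^ K ≤ q ^ t * (2 * N * Real.exp (2 * (K / q))) := by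
        gcongr
        exact h1.trans (by gcongr)
    _ = 2 * q ^ t * N * Real.exp (2 * (K / q)) := by ring
    _ ≤ Real.exp (K / q / 2) * N * Real.exp (2 * (K / q)) := by gcongr
    _ = N * Real.exp (K / q / 2 + 2 * (K / q)) := by rw [Real.exp_add]; ring
    _ ≤ N * Real.exp (-(3 * (K / q)) + Real.log 2 * (8 * K / q)) := by
        refine mul_le_mul_of_nonneg_left (Real.exp_le_exp.2 ?_) hN0
        rw [mul_div_assoc]
        nlinarith
    _ = _ := by rw [Real.exp_add]; ring

/-- The probability that a given right set overloads more than `m / q ^ (t + 1)` constraints is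
at most `exp (-20 n log q)`. -/
theorem many_overloaded_le_exp {q : ℝ} (hq : 1000 < q) {K t m : ℕ} (hK : q ^ 2 / 2 < K)
    (ht : t ≤ 10) {n N B A : ℝ} (hB0 : 0 ≤ B) (hN : 0 ≤ N)
    (hm : (40 * q ^ (t + 2) * Real.log q) / K * n ≤ m)
    (hB : B ≤ Real.exp (-(3 * (K / q))) * N)
    (hA : A * Real.exp (K / q * (m / q ^ (t + 1))) ≤ (N + (Real.exp (K / q) - 1) * B) ^ m) :
    A ≤ N ^ m * Real.exp (-(20 * n * Real.log q)) := by
  have hq0 : 0 < q := by linarith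
  have hKq : q / 2 ≤ K / q := by rw [le_div_iff₀ hq0]; nlinarith
  have hK0 : (0 : ℝ) < K := lt_of_le_of_lt (by positivity) hK
  have hsmall : Real.exp (-(2 * (K / q))) ≤ K / (2 * q ^ (t + 2)) := by
    have h1 : 4 * q ^ t ≤ Real.exp (2 * (K / q)) := by
      calc 4 * q ^ t ≤ q ^ (t + 1) := by
            rw [pow_succ']; gcongr; linarith
        _ ≤ Real.exp (q / 4) := pow_le_exp_div_four hq (by omega)
        _ ≤ _ := Real.exp_le_exp.2 (by linarith)
    rw [Real.exp_neg]
    calc _ ≤ (4 * q ^ t)⁻¹ := by gcongr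
      _ ≤ _ := by
        rw [inv_eq_one_div, div_le_div_iff₀ (by positivity) (by positivity), pow_add]
        have : 0 < q ^ t := by positivity
        nlinarith
  have h2 : N + (Real.exp (K / q) - 1) * B ≤ N * Real.exp (Real.exp (-(2 * (K / q)))) := by
    have h3 : (Real.exp (K / q) - 1) * B ≤ Real.exp (-(2 * (K / q))) * N := by
      calc (Real.exp (K / q) - 1) * B
          ≤ Real.exp (K / q) * (Real.exp (-(3 * (K / q))) * N) := by gcongr; linarith
        _ = _ := by rw [← mul_assoc, ← Real.exp_add]; congr 2; ring
    have h4 := Real.add_one_le_exp (Real.exp (-(2 * (K / q))))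
    nlinarith
  have h5 : 0 ≤ N + (Real.exp (K / q) - 1) * B := by
    have := Real.one_le_exp (show 0 ≤ K / q by positivity)
    have := mul_nonneg (sub_nonneg.2 this) hB0
    linarith
  have hexp : 40 * q ^ (t + 2) * Real.log q * n ≤ m * K := by
    rw [div_mul_eq_mul_div, div_le_iff₀ hK0] at hm
    exact hm
  refine le_of_mul_le_mul_right (hA.trans ?_) (Real.exp_pos (K / q * (m / q ^ (t + 1))))
  calc _ ≤ (N * Real.exp (Real.exp (-(2 * (K / q))))) ^ m := pow_le_pow_left₀ h5 h2 m
    _ = N ^ m * Real.exp (m * Real.exp (-(2 * (K / q)))) := by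
        rw [mul_pow, ← Real.exp_nat_mul]
    _ ≤ N ^ m * Real.exp (-(20 * n * Real.log q) + K / q * (m / q ^ (t + 1))) := by
        gcongr
        have h6 : (m : ℝ) * Real.exp (-(2 * (K / q))) ≤ m * (K / (2 * q ^ (t + 2))) := by gcongr
        have h7 : K / q * (m / q ^ (t + 1)) = 2 * (m * (K / (2 * q ^ (t + 2)))) := by
          field_simp
          ring
        have h8 : 20 * n * Real.log q ≤ m * (K / (2 * q ^ (t + 2))) := by
          rw [← mul_div_assoc, le_div_iff₀ (by positivity)]
          linarith
        linarith
    _ = _ := by rw [Real.exp_add]; ring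

theorem card_right_sets_le {F : Type*} [Fintype F] [DecidableEq F] (hF : 1 ≤ Fintype.card F)
    (n : ℕ) :
    ((Finset.univ.filter fun R : Finset (Fin n × F) => R.card ≤ 2 * n).card : ℝ) ≤
      Real.exp (2 * n * Real.log (Fintype.card F) + n) := by
  set q : ℝ := (Fintype.card F : ℝ) with hq
  have hq1 : 1 ≤ q := by rw [hq]; exact_mod_cast hF
  have hq0 : 0 < q := by linarith
  have h := card_finset_card_le_mul_pow_le (Fin n × F) (2 * n) q⁻¹ (by positivity)
    (inv_le_one_of_one_le₀ hq1)
  rw [inv_pow, ← div_eq_mul_inv, div_le_iff₀ (by positivity), Fintype.card_prod,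
    Fintype.card_fin] at h
  refine h.trans ?_
  calc (1 + q⁻¹) ^ (n * Fintype.card F) * q ^ (2 * n)
      ≤ (Real.exp q⁻¹) ^ (n * Fintype.card F) * q ^ (2 * n) := by
        gcongr
        linarith [Real.add_one_le_exp q⁻¹]
    _ = Real.exp n * Real.exp (2 * n * Real.log q) := by
        rw [← Real.exp_nat_mul, mul_comm (2 * (n : ℝ)), Real.exp_mul (Real.log q),
          Real.exp_log hq0]
        congr 1
        · push_cast
          rw [← hq, mul_assoc, mul_inv_cancel₀ hq0.ne', mul_one]
        · norm_cast
    _ = _ := by rw [← Real.exp_add, add_comm]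

theorem one_sub_le_prUnif {Ω : Type*} [Fintype Ω] (E : Set Ω) {ε : ℝ}
    (hpos : 0 < Fintype.card Ω) (h : (Eᶜ.ncard : ℝ) ≤ Fintype.card Ω * ε) :
    1 - ε ≤ prUnif E := by
  have h1 := Set.ncard_add_ncard_compl E
  rw [Nat.card_eq_fintype_card] at h1
  have h2 : (E.ncard : ℝ) + Eᶜ.ncard = Fintype.card Ω := by exact_mod_cast h1
  have h3 : (0 : ℝ) < Fintype.card Ω := by exact_mod_cast hpos
  rw [prUnif, le_div_iff₀ h3]
  linarith

theorem prUnif_le_one {Ω : Type*} [Fintype Ω] (E : Set Ω) : prUnif E ≤ 1 := by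
  have h1 := Set.ncard_add_ncard_compl E
  rw [Nat.card_eq_fintype_card] at h1
  have h2 : (E.ncard : ℝ) ≤ Fintype.card Ω := by exact_mod_cast (by omega)
  exact div_le_one_of_le₀ h2 (Nat.cast_nonneg _)

open Classical in
/-- Let `q > 1000` be a prime power (realized as a finite field `F`
with `|F| = q`), `K > q²/2`, `t ≤ 10`, and let `C` be the dual of a `[K, K−t, 2δ]_q`
code. For `β ≥ (40 q^{t+2} ln q)/K` (with `m n ≥ β n` constraints), a random
Max K-CSP(C) instance satisfies with probability `1 − o(1)`: every subgraph of the
constraint–variable graph `G_Φ` induced by at most `2m` left vertices `(Cᵢ, α)` (with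
`α` satisfying `Cᵢ`) and at most `2n` right vertices `(x_j, a)` contains at most
`17 m K / q` edges. -/
theorem csp_graph_soundness_whp (q : ℕ) (hq : 1000 < q)
    (F : Type) [Field F] [Fintype F] [DecidableEq F] (hF : Fintype.card F = q)
    (K t δ : ℕ) (hKq : (q : ℝ) ^ 2 / 2 < (K : ℝ)) (ht : t ≤ 10)
    (Ccode : Set (Fin K → F))
    (hdual : ∃ C' : Submodule F (Fin K → F),
      Module.finrank F C' = K - t ∧
      (∀ c ∈ C', c ≠ 0 → 2 * δ ≤ hammingNorm c) ∧
      Ccode = {c : Fin K → F | ∀ d ∈ C', ∑ j : Fin K, c j * d j = 0})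
    (m : ℕ → ℕ)
    (hm : ∀ n : ℕ, (40 * (q : ℝ) ^ (t + 2) * Real.log q) / (K : ℝ) * (n : ℝ) ≤ (m n : ℝ)) :
    Filter.Tendsto (fun n : ℕ => prUnif
      {ω : Fin (m n) → ({T : Fin K → Fin n // Function.Injective T} × (Fin K → F)) |
        ∀ Lset : Finset (Fin (m n) × (Fin K → F)),
          (∀ p ∈ Lset, (fun j => p.2 j + (ω p.1).2 j) ∈ Ccode) →
          Lset.card ≤ 2 * m n →
          ∀ Rset : Finset (Fin n × F), Rset.card ≤ 2 * n →
          (∑ p ∈ Lset, ∑ r ∈ Rset,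
            if ∃ j : Fin K, (ω p.1).1.1 j = r.1 ∧ p.2 j = r.2 then (1 : ℝ) else 0) ≤
            17 * (m n : ℝ) * (K : ℝ) / (q : ℝ)})
      Filter.atTop (nhds 1) := by
  obtain ⟨W, hW, -, hC⟩ := hdual
  subst hF
  have hq : (1000 : ℝ) < Fintype.card F := by exact_mod_cast hq
  set q : ℝ := (Fintype.card F : ℝ) with hqdef
  have hq0 : 0 < q := by linarith
  have hlog : 1 ≤ Real.log q := by
    rw [Real.le_log_iff_exp_le hq0]
    linarith [Real.exp_one_lt_d9]
  have htK : t ≤ K := by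
    have : (t : ℝ) ≤ 10 := by exact_mod_cast ht
    have : (t : ℝ) ≤ K := by nlinarith
    exact_mod_cast this
  have hcardC : Ccode.toFinset.card = Fintype.card F ^ t := by
    rw [← Set.ncard_eq_toFinset_card', hC]
    exact ncard_dual_code W (by simpa using htK) (by simpa using hW)
  have hcardC' : (Ccode.toFinset.card : ℝ) = q ^ t := by rw [hcardC]; push_cast; rfl
  refine tendsto_of_tendsto_of_tendsto_of_le_of_le' (g := fun n : ℕ => 1 - Real.exp (-(n : ℝ)))
    ?_ tendsto_const_nhds ?_ (Filter.Eventually.of_forall fun n => prUnif_le_one _)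
  · have := (Real.tendsto_exp_neg_atTop_nhds_zero.comp
      (tendsto_natCast_atTop_atTop (R := ℝ))).const_sub 1
    simpa using this
  filter_upwards [Filter.eventually_ge_atTop (2 * K ^ 2), Filter.eventually_gt_atTop 0]
    with n hn hn0
  have hn0' : (0 : ℝ) < n := by exact_mod_cast hn0
  set S := {T : Fin K → Fin n // Function.Injective T} × (Fin K → F) with hS
  set N : ℝ := (Fintype.card S : ℝ) with hNdef
  have hN : ((n : ℝ) * q) ^ K ≤ 2 * N := by
    have h := pow_le_two_mul_card_injective K n hn hn0
    have hcardS : Fintype.card S =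
        Nat.card {T : Fin K → Fin n // Function.Injective T} * Fintype.card F ^ K := by
      rw [← Nat.card_eq_fintype_card, hS, Nat.card_prod, Nat.card_fun, Nat.card_fin,
        Nat.card_eq_fintype_card (α := F)]
    rw [hNdef, hcardS, mul_pow]
    push_cast
    rw [← mul_assoc]
    gcongr
  have hNpos : 0 < N := by
    have : 0 < ((n : ℝ) * q) ^ K := by positivity
    linarith
  have hcardΩ : (Fintype.card (Fin (m n) → S) : ℝ) = N ^ m n := by
    rw [Fintype.card_pi_const]; push_cast; rfl
  refine one_sub_le_prUnif _ ?_ ?_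
  · have : (0 : ℝ) < Fintype.card (Fin (m n) → S) := by rw [hcardΩ]; positivity
    exact_mod_cast this
  rw [hcardΩ]
  set bad : Finset (Fin n × F) → Finset S := fun R => Set.toFinset
    {x : S | ∃ c ∈ Ccode.toFinset, 8 * K / q <
      ((Finset.univ.filter fun j => (x.1.1 j, c j - x.2 j) ∈ R).card : ℝ)} with hbad
  set fail : Finset (Fin n × F) → Finset (Fin (m n) → S) := fun R => Finset.univ.filter
    fun ω => (m n : ℝ) / q ^ (t + 1) <
      ((Finset.univ.filter fun i => ω i ∈ bad R).card : ℝ) with hfail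
  have hfailcard : ∀ R : Finset (Fin n × F), R.card ≤ 2 * n →
      ((fail R).card : ℝ) ≤ N ^ m n * Real.exp (-(20 * n * Real.log q)) := by
    intro R hR
    have hR' : (R.card : ℝ) ≤ 2 * n := by exact_mod_cast hR
    have h1 := card_overloaded_mul_le Ccode.toFinset R (8 * K / q) (Real.log 2)
      (Real.log_nonneg (by norm_num))
    rw [Real.exp_log (by norm_num), hcardC', Set.ncard_eq_toFinset_card'] at h1
    norm_num only [one_mul] at h1
    have h2 := overloaded_le_exp hq hKq ht hn0' hR' (Nat.cast_nonneg _) hN h1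
    refine many_overloaded_le_exp hq hKq ht (Nat.cast_nonneg _) hNpos.le (hm n) h2 ?_
    have h3 := card_many_hits_mul_le (ι := Fin (m n)) (bad R) (m n / q ^ (t + 1)) (K / q)
      (by positivity)
    rw [Fintype.card_fin] at h3
    exact h3
  have hsub : {ω : Fin (m n) → S |
        ∀ Lset : Finset (Fin (m n) × (Fin K → F)),
          (∀ p ∈ Lset, (fun j => p.2 j + (ω p.1).2 j) ∈ Ccode) →
          Lset.card ≤ 2 * m n →
          ∀ Rset : Finset (Fin n × F), Rset.card ≤ 2 * n →
          (∑ p ∈ Lset, ∑ r ∈ Rset,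
            if ∃ j : Fin K, (ω p.1).1.1 j = r.1 ∧ p.2 j = r.2 then (1 : ℝ) else 0) ≤
            17 * (m n : ℝ) * (K : ℝ) / q}ᶜ ⊆
      ((Finset.univ.filter fun R : Finset (Fin n × F) => R.card ≤ 2 * n).biUnion fail :
        Finset _) := by
    intro ω hω
    by_contra hnot
    refine hω fun L hL hLcard R hR => ?_
    have hnfail : ω ∉ fail R := fun h => hnot <| by
      rw [Finset.mem_coe]
      exact Finset.mem_biUnion.2 ⟨R, Finset.mem_filter.2 ⟨Finset.mem_univ _, hR⟩, h⟩
    have hB : ((Finset.univ.filter fun i => ω i ∈ bad R).card : ℝ) ≤ m n / q ^ (t + 1) := by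
      by_contra! h
      exact hnfail (Finset.mem_filter.2 ⟨Finset.mem_univ _, h⟩)
    have h := sum_edges_le Ccode.toFinset ω L (fun p hp => Set.mem_toFinset.2 (hL p hp)) R
      (8 * K / q) (by positivity) (Finset.univ.filter fun i => ω i ∈ bad R)
      (fun i hi => Finset.mem_filter.2 ⟨Finset.mem_univ _, Set.mem_toFinset.2 hi⟩)
    refine h.trans ?_
    have hL' : (L.card : ℝ) ≤ 2 * m n := by exact_mod_cast hLcard
    rw [hcardC']
    calc _ ≤ 2 * (m n : ℝ) * (8 * K / q) + m n / q ^ (t + 1) * q ^ t * K := by gcongr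
      _ = _ := by field_simp; ring
  have hcount := card_right_sets_le (F := F) Fintype.card_pos n
  calc _ ≤ (((Finset.univ.filter fun R : Finset (Fin n × F) => R.card ≤ 2 * n).biUnion
          fail).card : ℝ) := by
        rw [← Set.ncard_coe_finset]
        exact_mod_cast Set.ncard_le_ncard hsub (Finset.finite_toSet _)
    _ ≤ ∑ R ∈ Finset.univ.filter fun R : Finset (Fin n × F) => R.card ≤ 2 * n,
          ((fail R).card : ℝ) := by exact_mod_cast Finset.card_biUnion_le
    _ ≤ ∑ R ∈ Finset.univ.filter fun R : Finset (Fin n × F) => R.card ≤ 2 * n,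
          N ^ m n * Real.exp (-(20 * n * Real.log q)) :=
        Finset.sum_le_sum fun R hR => hfailcard R (Finset.mem_filter.1 hR).2
    _ ≤ Real.exp (2 * n * Real.log q + n) *
          (N ^ m n * Real.exp (-(20 * n * Real.log q))) := by
        rw [Finset.sum_const, nsmul_eq_mul]
        gcongr
    _ = N ^ m n * Real.exp (2 * n * Real.log q + n + -(20 * n * Real.log q)) := by
        rw [Real.exp_add _ (-(20 * n * Real.log q))]; ring
    _ ≤ N ^ m n * Real.exp (-n) := by
        gcongr
        nlinarith
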